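/- Let R be a commutative ring with 1 + 1 = 0 and let (A, ω) be a curved associative algebra over R. Let M be an R-module equipped with R-linear maps m_j : M ⊗ A^{⊗(j−1)} → M for j ≥ 1 satisfying the A_∞-module relations over (A, ω): for every n ≥ 1, all x ∈ M and all a₁, …, a_{n−1} ∈ A, ∑_{j=1}^{n} m_{n+1−j}( m_j(x ⊗ a₁ ⊗ … ⊗ a_{j−1}) ⊗ a_j ⊗ … ⊗ a_{n−1} ) + ∑_{p=1}^{n−2} m_{n−1}( x ⊗ a₁ ⊗ … ⊗ (a_p · a_{p+1}) ⊗ … ⊗ a_{n−1} ) + ∑_{p=0}^{n−1} m_{n+1}( x ⊗ a₁ ⊗ … ⊗ a_p ⊗ ω ⊗ a_{p+1} ⊗ … ⊗ a_{n−1} ) = 0. Let (X, δ) be an ω-curved type D-structure over (A, ω), with iterates δ^j : X → A^{⊗j} ⊗ X, and assume either that (X, δ) is operationally bounded (δ^j = 0 for all sufficiently large j) or that M is operationally bounded (m_j = 0 for all sufficiently large j). Define D : M ⊗_R X → M ⊗_R X by D = ∑_{j=0}^{∞} (m_{j+1} ⊗ id_X) ∘ (id_M ⊗ δ^j), using the canonical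 identification M ⊗ (A^{⊗j} ⊗ X) ≅ (M ⊗ A^{⊗j}) ⊗ X. Then D ∘ D = 0, i.e. (M ⊗_R X, D) is a chain complex. -/

import Mathlib

open TensorProduct Finset

noncomputable section

variable (R : Type) [CommRing R]

/-- `TP R B j` is the `j`-fold tensor power `B^{⊗j}` (with `B^{⊗0} = R`),
nested as `B ⊗ (B ⊗ (⋯ ⊗ R))`. -/
def TP (B : Type) [Ring B] [Algebra R B] : ℕ → ModuleCat R
  | 0 => ModuleCat.of R R
  | j + 1 => ModuleCat.of R (B ⊗[R] ↥(TP B j))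

/-- The pure tensor `f 0 ⊗ f 1 ⊗ ⋯ ⊗ f (j-1) ⊗ 1` in `TP R B j`. -/
def purePow (B : Type) [Ring B] [Algebra R B] (f : ℕ → B) : (j : ℕ) → ↥(TP R B j)
  | 0 => (1 : R)
  | j + 1 => f 0 ⊗ₜ[R] purePow B (fun i => f (i + 1)) j

/-- `Tpow R B X j` is `B^{⊗j} ⊗ X`, nested as `B ⊗ (B ⊗ (⋯ ⊗ X))`. -/
def Tpow (B : Type) [Ring B] [Algebra R B] (X : ModuleCat R) : ℕ → ModuleCat R
  | 0 => X
  | j + 1 => ModuleCat.of R (B ⊗[R] ↥(Tpow B X j))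

/-- `id_{B^{⊗j}} ⊗ δ : B^{⊗j} ⊗ X ⟶ B^{⊗(j+1)} ⊗ X`. -/
def extendD (B : Type) [Ring B] [Algebra R B] (X : ModuleCat R)
    (δ : ↥X →ₗ[R] B ⊗[R] ↥X) : (j : ℕ) → (↥(Tpow R B X j) →ₗ[R] ↥(Tpow R B X (j + 1)))
  | 0 => δ
  | j + 1 => LinearMap.lTensor B (extendD B X δ j)

/-- The iterate `δ^j : X ⟶ B^{⊗j} ⊗ X` of a type-`D` structure map `δ`,
defined by `δ^0 = id` and `δ^j = (id_{B^{⊗(j-1)}} ⊗ δ) ∘ δ^{j-1}`. -/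
def iter (B : Type) [Ring B] [Algebra R B] (X : ModuleCat R)
    (δ : ↥X →ₗ[R] B ⊗[R] ↥X) : (j : ℕ) → (↥X →ₗ[R] ↥(Tpow R B X j))
  | 0 => LinearMap.id
  | j + 1 => (extendD R B X δ j) ∘ₗ (iter B X δ j)

/-- The canonical rearrangement `N ⊗ (B^{⊗j} ⊗ X) ≅ (N ⊗ B^{⊗j}) ⊗ X`. -/
def rearr (B : Type) [Ring B] [Algebra R B] (X : ModuleCat R) :
    (j : ℕ) → (N : ModuleCat R) →
      ((↥N ⊗[R] ↥(Tpow R B X j)) ≃ₗ[R] ((↥N ⊗[R] ↥(TP R B j)) ⊗[R] ↥X))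
  | 0, N => TensorProduct.congr (TensorProduct.rid R ↥N).symm (LinearEquiv.refl R ↥X)
  | j + 1, N =>
      (TensorProduct.assoc R ↥N B ↥(Tpow R B X j)).symm.trans
        ((rearr B X j (ModuleCat.of R (↥N ⊗[R] B))).trans
          (TensorProduct.congr (TensorProduct.assoc R ↥N B ↥(TP R B j))
            (LinearEquiv.refl R ↥X)))

section helpers
universe u v w
variable {R}
variable {A : Type} [Ring A] [Algebra R A]

def pureX {X : ModuleCat.{v} R} (y : X) : (f : ℕ → A) → (j : ℕ) → ↥(Tpow R A X j)
  | _, 0 => y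
  | f, j + 1 => f 0 ⊗ₜ[R] pureX y (fun i => f (i + 1)) j

theorem sumComp {ι : Type} {V : Type u} {W : Type v} {U : Type w} [AddCommGroup V] [AddCommGroup W]
    [AddCommGroup U] [Module R V] [Module R W] [Module R U] (s : Finset ι)
    (f : ι → (W →ₗ[R] U)) (g : V →ₗ[R] W) : (∑ i ∈ s, f i) ∘ₗ g = ∑ i ∈ s, f i ∘ₗ g := by
  ext x; simp

theorem compSum {ι : Type} {V : Type u} {W : Type v} {U : Type w} [AddCommGroup V] [AddCommGroup W]
    [AddCommGroup U] [Module R V] [Module R W] [Module R U] (s : Finset ι)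
    (f : ι → (V →ₗ[R] W)) (g : W →ₗ[R] U) : g ∘ₗ (∑ i ∈ s, f i) = ∑ i ∈ s, g ∘ₗ f i := by
  ext x; simp

theorem ext_pureX {X : ModuleCat.{v} R} : ∀ (j : ℕ) {P : Type w} [AddCommGroup P] [Module R P]
    (f g : ↥(Tpow R A X j) →ₗ[R] P) 
    (_ : ∀ (a : ℕ → A) (y : X), f (pureX y a j) = g (pureX y a j)), f = g
  | 0, _, _, _, f, g, h => LinearMap.ext fun y => h (fun _ => 0) y
  | j + 1, P, _, _, f, g, h => by
    apply TensorProduct.ext'  (R := R) (M := A) (N := Tpow R A X j)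
    intro a t
    have := ext_pureX j (f ∘ₗ TensorProduct.mk R A (Tpow R A X j) a)
      (g ∘ₗ TensorProduct.mk R A (Tpow R A X j) a) (fun b y => 
        h (fun i => Nat.casesOn (motive := fun _ => A) i a b) y)
    exact LinearMap.congr_fun this t

theorem ext_pureX2 {X : ModuleCat.{v} R} {N : ModuleCat.{u} R} (j : ℕ) {P : Type w} [AddCommGroup P] [Module R P]
    (f g : ↥N ⊗[R] ↥(Tpow R A X j) →ₗ[R] P) 
    (h : ∀ (x : N) (a : ℕ → A) (y : X), f (x ⊗ₜ pureX y a j) = g (x ⊗ₜ pureX y a j)) : f = g := by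
  apply TensorProduct.ext'
  intro x t
  have := ext_pureX j (f ∘ₗ TensorProduct.mk R N (Tpow R A X j) x)
      (g ∘ₗ TensorProduct.mk R N (Tpow R A X j) x) (fun b y => h x b y)
  exact LinearMap.congr_fun this t

theorem rearr_pure {X : ModuleCat.{v} R} (y : X) : ∀ (j : ℕ) (N : ModuleCat.{u} R) (x : N) (a : ℕ → A),
    rearr R A X j N (x ⊗ₜ pureX y a j) = (x ⊗ₜ purePow R A a j) ⊗ₜ y
  | 0, N, x, a => rfl
  | j + 1, N, x, a => by
    have := rearr_pure y j (ModuleCat.of R (↥N ⊗[R] A)) (x ⊗ₜ a 0) (fun i => a (i + 1))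
    exact congrArg (TensorProduct.congr (TensorProduct.assoc R ↥N A ↥(TP R A j))
            (LinearEquiv.refl R ↥X)) this

/-- apply a map at the end -/
def tmap {X : ModuleCat.{v} R} {Y : ModuleCat.{w} R} (g : X →ₗ[R] Y) : (j : ℕ) → (↥(Tpow R A X j) →ₗ[R] ↥(Tpow R A Y j))
  | 0 => g
  | j + 1 => LinearMap.lTensor A (tmap g j)

theorem tmap_pure {X : ModuleCat.{v} R} {Y : ModuleCat.{w} R} (g : X →ₗ[R] Y) (y : X) : ∀ (j : ℕ) (a : ℕ → A),
    tmap g j (pureX y a j) = pureX (g y) a j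
  | 0, a => rfl
  | j + 1, a => congrArg (a 0 ⊗ₜ[R] ·) (tmap_pure g y j (fun i => a (i + 1)))

/-- glue -/
def glue (X : ModuleCat.{v} R) (k : ℕ) : (j : ℕ) →
    (↥(Tpow R A (Tpow R A X k) j) ≃ₗ[R] ↥(Tpow R A X (k + j)))
  | 0 => LinearEquiv.refl R _
  | j + 1 => LinearEquiv.lTensor A (glue X k j)

theorem glue_pure {X : ModuleCat.{v} R} (y : X) (k : ℕ) : ∀ (j : ℕ) (a : ℕ → A),
    glue X k j (pureX (pureX y (fun i => a (i + j)) k) a j) = pureX y a (k + j)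
  | 0, a => rfl
  | j + 1, a => congrArg (a 0 ⊗ₜ[R] ·) (glue_pure y k j (fun i => a (i + 1)))

variable {X : ModuleCat.{v} R} (δ : ↥X →ₗ[R] A ⊗[R] ↥X)

theorem iter_succ' : ∀ j : ℕ, iter R A X δ (j + 1) = LinearMap.lTensor A (iter R A X δ j) ∘ₗ δ
  | 0 => by
    apply LinearMap.ext; intro x
    exact (LinearMap.congr_fun (LinearMap.lTensor_id A X) (δ x)).symm
  | j + 1 => by
    apply LinearMap.ext; intro x
    refine (congrArg (extendD R A X δ (j + 1)) (LinearMap.congr_fun (iter_succ' j) x)).trans ?_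
    exact (LinearMap.lTensor_comp_apply A (extendD R A X δ j) (iter R A X δ j) (δ x)).symm

theorem iter_add (k : ℕ) : ∀ j : ℕ, iter R A X δ (k + j) =
    (glue X k j).toLinearMap ∘ₗ tmap (iter R A X δ k) j ∘ₗ iter R A X δ j
  | 0 => rfl
  | j + 1 => by
    change iter R A X δ ((k + j) + 1) = _
    rw [iter_succ', iter_succ', iter_add k j, LinearMap.lTensor_comp, LinearMap.lTensor_comp]
    rfl

/-- multiply at position q -/
def mulAt (X : ModuleCat.{v} R) : (n q : ℕ) → (↥(Tpow R A X (n + 2)) →ₗ[R] ↥(Tpow R A X (n + 1)))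
  | n, 0 => (TensorProduct.map (LinearMap.mul' R A) (LinearMap.id : ↥(Tpow R A X n) →ₗ[R] _)) ∘ₗ
        (TensorProduct.assoc R A A ↥(Tpow R A X n)).symm.toLinearMap
  | 0, _ + 1 => 0
  | n + 1, q + 1 => LinearMap.lTensor A (mulAt X n q)

/-- insert ω at position q -/
def insAt (ω : A) (X : ModuleCat.{v} R) : (n q : ℕ) → (↥(Tpow R A X n) →ₗ[R] ↥(Tpow R A X (n + 1)))
  | n, 0 => TensorProduct.mk R A (Tpow R A X n) ω
  | 0, _ + 1 => 0
  | n + 1, q + 1 => LinearMap.lTensor A (insAt ω X n q)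

theorem mulAt_pure (y : X) : ∀ (n q : ℕ) (_ : q ≤ n) (a : ℕ → A),
    mulAt X n q (pureX y a (n + 2)) = pureX y
      (fun i => if i < q then a i else if i = q then a q * a (q + 1) else a (i + 1)) (n + 1)
  | 0, 0, _, a => rfl
  | n + 1, 0, _, a => rfl
  | n + 1, q + 1, h, a => by
    refine (congrArg (a 0 ⊗ₜ[R] ·) (mulAt_pure y n q (by omega) (fun i => a (i + 1)))).trans ?_
    simp only [pureX, Nat.add_lt_add_iff_right, Nat.add_right_cancel_iff]
    simp

theorem insAt_pure (ω : A) (y : X) : ∀ (n q : ℕ) (_ : q ≤ n) (a : ℕ → A),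
    insAt ω X n q (pureX y a n) = pureX y
      (fun i => if i < q then a i else if i = q then ω else a (i - 1)) (n + 1)
  | 0, 0, _, a => rfl
  | n + 1, 0, _, a => rfl
  | n + 1, q + 1, h, a => by
    refine (congrArg (a 0 ⊗ₜ[R] ·) (insAt_pure ω y n q (by omega) (fun i => a (i + 1)))).trans ?_
    have : ∀ i, (if i < q then a (i + 1) else if i = q then ω else a (i - 1 + 1)) =
        (if i + 1 < q + 1 then a (i + 1) else if i + 1 = q + 1 then ω else a (i + 1 - 1)) := by
      intro i
      rcases lt_trichotomy i q with h | h | h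
      · simp [h]
      · simp [h]
      · have : i - 1 + 1 = i := by omega
        simp [this]
    simp only [this]
    rfl

theorem mul_nat {X : Type v} {Y : Type w} [AddCommGroup X] [AddCommGroup Y] [Module R X] [Module R Y]
    (g : X →ₗ[R] Y) :
    ((TensorProduct.map (LinearMap.mul' R A) (LinearMap.id : Y →ₗ[R] Y)) ∘ₗ
        (TensorProduct.assoc R A A Y).symm.toLinearMap) ∘ₗ
        LinearMap.lTensor A (LinearMap.lTensor A g) =
      LinearMap.lTensor A g ∘ₗ
        (TensorProduct.map (LinearMap.mul' R A) (LinearMap.id : X →ₗ[R] X)) ∘ₗ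
        (TensorProduct.assoc R A A X).symm.toLinearMap := by
  ext a b x
  simp

theorem mulAt_iter (ω : A) (hδ : (TensorProduct.map (LinearMap.mul' R A) (LinearMap.id : ↥X →ₗ[R] ↥X)) ∘ₗ
        (TensorProduct.assoc R A A ↥X).symm.toLinearMap ∘ₗ
        (LinearMap.lTensor A δ) ∘ₗ δ
      = TensorProduct.mk R A ↥X ω) : ∀ (n q : ℕ) (_ : q ≤ n),
    mulAt X n q ∘ₗ iter R A X δ (n + 2) = insAt ω X n q ∘ₗ iter R A X δ n
  | n, 0, _ => by
    have h1 : mulAt X n 0 ∘ₗ LinearMap.lTensor A (LinearMap.lTensor A (iter R A X δ n)) =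
      LinearMap.lTensor A (iter R A X δ n) ∘ₗ 
        (TensorProduct.map (LinearMap.mul' R A) (LinearMap.id : ↥X →ₗ[R] ↥X)) ∘ₗ
        (TensorProduct.assoc R A A ↥X).symm.toLinearMap := by
      cases n <;> exact mul_nat _
    apply LinearMap.ext; intro x
    have h2 := LinearMap.congr_fun h1 (LinearMap.lTensor A δ (δ x))
    have h3 := congrArg (LinearMap.lTensor A) (iter_succ' δ n)
    have h4 : iter R A X δ (n + 2) x =
        LinearMap.lTensor A (LinearMap.lTensor A (iter R A X δ n)) (LinearMap.lTensor A δ (δ x)) := by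
      refine (LinearMap.congr_fun (iter_succ' δ (n + 1)) x).trans ?_
      refine (LinearMap.congr_fun h3 (δ x)).trans ?_
      exact LinearMap.lTensor_comp_apply A _ _ _
    refine (congrArg (mulAt X n 0) h4).trans ?_
    refine h2.trans ?_
    refine (congrArg (LinearMap.lTensor A (iter R A X δ n)) (LinearMap.congr_fun hδ x)).trans ?_
    cases n <;> rfl
  | n + 1, q + 1, h => by
    have := mulAt_iter ω hδ n q (by omega)
    rw [iter_succ' δ (n + 2), iter_succ' δ n]
    apply LinearMap.ext; intro x
    have h2 := LinearMap.congr_fun (congrArg (LinearMap.lTensor A) this) (δ x)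
    rw [LinearMap.lTensor_comp_apply, LinearMap.lTensor_comp_apply] at h2
    exact h2


variable {N : ModuleCat.{u} R} 

/-- apply a multilinear operation to the first factors -/
def Phi {N' : ModuleCat.{u} R} {j : ℕ} (f : (↥N ⊗[R] ↥(TP R A j)) →ₗ[R] ↥N')
    (X : ModuleCat.{v} R) : (↥N ⊗[R] ↥(Tpow R A X j)) →ₗ[R] (↥N' ⊗[R] ↥X) :=
  (TensorProduct.map f (LinearMap.id : ↥X →ₗ[R] ↥X)) ∘ₗ (rearr R A X j N).toLinearMap

theorem Phi_pure {j : ℕ} (f : (↥N ⊗[R] ↥(TP R A j)) →ₗ[R] ↥N) (x : N) (y : X) (a : ℕ → A) :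
    Phi f X (x ⊗ₜ pureX y a j) = f (x ⊗ₜ purePow R A a j) ⊗ₜ y := by
  refine (congrArg (TensorProduct.map f (LinearMap.id : ↥X →ₗ[R] ↥X))
    (rearr_pure y j N x a)).trans ?_
  exact TensorProduct.map_tmul _ _ _ _

theorem Phi_nat {Y : ModuleCat.{v} R} {j : ℕ} (f : (↥N ⊗[R] ↥(TP R A j)) →ₗ[R] ↥N)
    (g : X →ₗ[R] Y) :
    Phi f Y ∘ₗ LinearMap.lTensor N (tmap g j) = LinearMap.lTensor N g ∘ₗ Phi f X := by
  apply ext_pureX2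
  intro x a y
  rw [LinearMap.comp_apply, LinearMap.comp_apply, Phi_pure, LinearMap.lTensor_tmul,
    LinearMap.lTensor_tmul, tmap_pure, Phi_pure]

variable (mm : (j : ℕ) → ((↥N ⊗[R] ↥(TP R A j)) →ₗ[R] ↥N))

/-- j-th term of the differential -/
def dd (j : ℕ) : (↥N ⊗[R] ↥X) →ₗ[R] (↥N ⊗[R] ↥X) :=
  Phi (mm j) X ∘ₗ LinearMap.lTensor N (iter R A X δ j)

theorem dd_comp (n j k : ℕ) (h : k + j = n) :
    ∃ L : (↥N ⊗[R] ↥(Tpow R A X n)) →ₗ[R] (↥N ⊗[R] ↥X),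
      (∀ (x : N) (a : ℕ → A) (y : X), L (x ⊗ₜ pureX y a n) =
        mm k ((mm j (x ⊗ₜ[R] purePow R A a j)) ⊗ₜ[R] purePow R A (fun i => a (i + j)) k) ⊗ₜ y) ∧
      dd δ mm k ∘ₗ dd δ mm j = L ∘ₗ LinearMap.lTensor N (iter R A X δ n) := by
  subst h
  refine ⟨Phi (mm k) X ∘ₗ Phi (mm j) (Tpow R A X k) ∘ₗ
    LinearMap.lTensor N (glue X k j).symm.toLinearMap, ?_, ?_⟩
  · intro x a y
    rw [LinearMap.comp_apply, LinearMap.comp_apply, LinearMap.lTensor_tmul, ← glue_pure,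
      LinearEquiv.coe_coe, LinearEquiv.symm_apply_apply, Phi_pure, Phi_pure]
  · have h1 : (glue X k j).symm.toLinearMap ∘ₗ iter R A X δ (k + j) =
        tmap (iter R A X δ k) j ∘ₗ iter R A X δ j := by
      rw [iter_add]
      apply LinearMap.ext; intro x
      exact LinearEquiv.symm_apply_apply _ _
    rw [LinearMap.comp_assoc, LinearMap.comp_assoc, ← LinearMap.lTensor_comp, h1,
      LinearMap.lTensor_comp, ← LinearMap.comp_assoc _ _ (Phi (mm j) (Tpow R A X k)), Phi_nat]
    rfl

/-- curvature terms -/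
def CC (ω : A) (n : ℕ) : (↥N ⊗[R] ↥X) →ₗ[R] (↥N ⊗[R] ↥X) :=
  ∑ p ∈ Finset.range (n + 1), Phi (mm (n + 1)) X ∘ₗ LinearMap.lTensor N (insAt ω X n p) ∘ₗ
    LinearMap.lTensor N (iter R A X δ n)

/-- multiplication terms -/
def BB (ω : A) : ℕ → ((↥N ⊗[R] ↥X) →ₗ[R] (↥N ⊗[R] ↥X))
  | 0 => 0
  | 1 => 0
  | n + 2 => CC δ mm ω n

theorem rel (ω : A)
    (hmm : ∀ n : ℕ, 1 ≤ n → ∀ (x : ↥N) (a : ℕ → A),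
      (∑ j ∈ Finset.range n,
          mm (n - 1 - j) ((mm j (x ⊗ₜ[R] purePow R A a j)) ⊗ₜ[R]
            purePow R A (fun i => a (i + j)) (n - 1 - j)))
        + (∑ q ∈ Finset.range (n - 2),
            mm (n - 2) (x ⊗ₜ[R] purePow R A
              (fun i => if i < q then a i else if i = q then a q * a (q + 1) else a (i + 1))
              (n - 2)))
        + (∑ p ∈ Finset.range n,
            mm n (x ⊗ₜ[R] purePow R A
              (fun i => if i < p then a i else if i = p then ω else a (i - 1)) n)) = 0)
    (hδ : (TensorProduct.map (LinearMap.mul' R A) (LinearMap.id : ↥X →ₗ[R] ↥X)) ∘ₗ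
        (TensorProduct.assoc R A A ↥X).symm.toLinearMap ∘ₗ
        (LinearMap.lTensor A δ) ∘ₗ δ
      = TensorProduct.mk R A ↥X ω) (n : ℕ) :
    (∑ j ∈ Finset.range (n + 1), dd δ mm (n - j) ∘ₗ dd δ mm j) + BB δ mm ω n + CC δ mm ω n = 0 := by
  have h1 : ∀ j, ∃ L : (↥N ⊗[R] ↥(Tpow R A X n)) →ₗ[R] (↥N ⊗[R] ↥X), j ∈ Finset.range (n + 1) →
      (∀ (x : N) (a : ℕ → A) (y : X), L (x ⊗ₜ pureX y a n) =
        mm (n - j) ((mm j (x ⊗ₜ[R] purePow R A a j)) ⊗ₜ[R]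
          purePow R A (fun i => a (i + j)) (n - j)) ⊗ₜ y) ∧
      dd δ mm (n - j) ∘ₗ dd δ mm j = L ∘ₗ LinearMap.lTensor N (iter R A X δ n) := by
    intro j
    by_cases h : j ∈ Finset.range (n + 1)
    · obtain ⟨L, hL⟩ := dd_comp δ mm n j (n - j) (by have := Finset.mem_range.1 h; omega)
      exact ⟨L, fun _ => hL⟩
    · exact ⟨0, fun h' => absurd h' h⟩
  choose L hL using h1
  have h2 : ∃ B : (↥N ⊗[R] ↥(Tpow R A X n)) →ₗ[R] (↥N ⊗[R] ↥X),
      (∀ (x : N) (a : ℕ → A) (y : X), B (x ⊗ₜ pureX y a n) =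
        (∑ q ∈ Finset.range (n - 1),
            mm (n - 1) (x ⊗ₜ[R] purePow R A
              (fun i => if i < q then a i else if i = q then a q * a (q + 1) else a (i + 1))
              (n - 1))) ⊗ₜ y) ∧
      BB δ mm ω n = B ∘ₗ LinearMap.lTensor N (iter R A X δ n) := by
    match n with
    | 0 => exact ⟨0, by simp, by simp [BB]⟩
    | 1 => exact ⟨0, by simp, by simp [BB]⟩
    | n + 2 =>
      refine ⟨∑ q ∈ Finset.range (n + 1), Phi (mm (n + 1)) X ∘ₗ LinearMap.lTensor N (mulAt X n q),
        ?_, ?_⟩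
      · intro x a y
        rw [LinearMap.sum_apply, TensorProduct.sum_tmul]
        refine Finset.sum_congr rfl fun q hq => ?_
        rw [LinearMap.comp_apply, LinearMap.lTensor_tmul,
          mulAt_pure y n q (by have := Finset.mem_range.1 hq; omega), Phi_pure]
        rfl
      · rw [sumComp, BB, CC]
        refine Finset.sum_congr rfl fun q hq => ?_
        rw [LinearMap.comp_assoc, ← LinearMap.lTensor_comp, ← LinearMap.lTensor_comp,
          mulAt_iter δ ω hδ n q (by have := Finset.mem_range.1 hq; omega)]
  obtain ⟨B, hB, hB'⟩ := h2
  have h3 : CC δ mm ω n = (∑ p ∈ Finset.range (n + 1), Phi (mm (n + 1)) X ∘ₗ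
      LinearMap.lTensor N (insAt ω X n p)) ∘ₗ LinearMap.lTensor N (iter R A X δ n) := by
    rw [sumComp]; rfl
  rw [hB', h3, Finset.sum_congr rfl fun j hj => (hL j hj).2, ← sumComp,
    ← LinearMap.add_comp, ← LinearMap.add_comp]
  suffices h : (∑ j ∈ Finset.range (n + 1), L j) + B + (∑ p ∈ Finset.range (n + 1),
      Phi (mm (n + 1)) X ∘ₗ LinearMap.lTensor N (insAt ω X n p)) = 0 by
    rw [h, LinearMap.zero_comp]
  apply ext_pureX2
  intro x a y
  have key := congrArg (fun z : N => z ⊗ₜ[R] y) (hmm (n + 1) (by omega) x a)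
  simp only [TensorProduct.add_tmul, TensorProduct.sum_tmul, TensorProduct.zero_tmul] at key
  rw [LinearMap.add_apply, LinearMap.add_apply, LinearMap.sum_apply, LinearMap.sum_apply, hB,
    LinearMap.zero_apply, TensorProduct.sum_tmul]
  refine Eq.trans ?_ key
  refine congrArg₂ _ (congrArg₂ _ ?_ rfl) ?_
  · exact Finset.sum_congr rfl fun j hj => (hL j hj).1 x a y
  · refine Finset.sum_congr rfl fun p hp => ?_
    rw [LinearMap.comp_apply, LinearMap.lTensor_tmul,
          insAt_pure ω y n p (by have := Finset.mem_range.1 hp; omega), Phi_pure]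

theorem telescope {V : Type w} [AddCommGroup V] (hV : ∀ v : V, v + v = 0) (S C B : ℕ → V)
    (h0 : B 0 = 0) (h1 : B 1 = 0) (hB : ∀ n, B (n + 2) = C n) (h : ∀ n, S n + B n + C n = 0)
    (K : ℕ) : ∑ n ∈ Finset.range (K + 2), S n + C K + C (K + 1) = 0 := by
  induction K with
  | zero =>
    have a := h 0
    have b := h 1
    rw [h0] at a; rw [h1] at b
    simp only [Finset.sum_range_succ, Finset.sum_range_zero]
    calc _ = (S 0 + 0 + C 0) + (S 1 + 0 + C 1) := by abel_nf
      _ = 0 := by rw [a, b, add_zero]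
  | succ K ih =>
    rw [Finset.sum_range_succ]
    have a := h (K + 2)
    rw [hB] at a
    calc _ = (∑ n ∈ Finset.range (K + 2), S n + C K + C (K + 1)) +
          (S (K + 2) + C K + C (K + 2)) - (C K + C K) := by abel
      _ = 0 := by rw [ih, a, hV (C K)]; simp

theorem sum_pairs {V : Type w} [AddCommGroup V] (f : ℕ → ℕ → V) (J : ℕ)
    (h1 : ∀ i j, J ≤ i → f i j = 0) (h2 : ∀ i j, J ≤ j → f i j = 0) :
    ∑ i ∈ Finset.range J, ∑ j ∈ Finset.range J, f i j =
      ∑ n ∈ Finset.range (2 * J + 2), ∑ j ∈ Finset.range (n + 1), f (n - j) j := by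
  have e : ∀ n, ∑ j ∈ Finset.range (n + 1), f (n - j) j =
      ∑ p ∈ Finset.HasAntidiagonal.antidiagonal n, f p.2 p.1 := fun n =>
    (Finset.Nat.sum_antidiagonal_eq_sum_range_succ (fun i j => f j i) n).symm
  simp only [e]
  rw [Finset.sum_comm, ← Finset.sum_product' (Finset.range J) (Finset.range J) (fun x y => f y x),
    ← Finset.sum_fiberwise_of_maps_to (t := Finset.range (2 * J + 2)) (g := fun p => p.1 + p.2)]
  · refine Finset.sum_congr rfl fun n _ => ?_
    refine Finset.sum_subset ?_ ?_
    · intro p hp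
      simp only [Finset.mem_filter] at hp
      simp [hp.2]
    · intro p hp hp'
      simp only [Finset.mem_filter, Finset.mem_product, Finset.mem_range,
        Finset.HasAntidiagonal.mem_antidiagonal] at hp hp'
      by_cases h : p.1 < J
      · exact h1 _ _ (by by_contra hc; exact hp' ⟨⟨h, by omega⟩, hp⟩)
      · exact h2 _ _ (by omega)
  · intro p hp
    simp only [Finset.mem_product, Finset.mem_range] at hp ⊢
    omega

end helpers

/-- **The box tensor product of an `A_∞`-module and a type `D`-structure is a chain
complex.**
Let `R` be a commutative ring with `1 + 1 = 0` and `(A, ω)` a curved associative algebra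
over `R`.  Let `M` be an `R`-module with maps `m_j : M ⊗ A^{⊗(j-1)} → M` (`j ≥ 1`, here
`mm j` is `m_{j+1}`, with `j` algebra inputs fed as a pure tensor in `TP R A j`) satisfying
the `A_∞`-module relations over `(A, ω)`, and let `(X, δ)` be an `ω`-curved type
`D`-structure over `(A, ω)`; assume one of the two is operationally bounded.  Then
`D = ∑_{j≥0} (m_{j+1} ⊗ id_X) ∘ (id_M ⊗ δ^j)` satisfies `D ∘ D = 0`,
i.e. `(M ⊗ X, D)` is a chain complex. -/
theorem boxTensor_differential_squares_to_zero
    (h2 : (1 : R) + 1 = 0)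
    (A : Type) [Ring A] [Algebra R A]
    (ω : A) (hω : ∀ a : A, ω * a = a * ω)
    (M : ModuleCat R)
    (mm : (j : ℕ) → ((↥M ⊗[R] ↥(TP R A j)) →ₗ[R] ↥M))
    (hmm : ∀ n : ℕ, 1 ≤ n → ∀ (x : ↥M) (a : ℕ → A),
      (∑ j ∈ Finset.range n,
          mm (n - 1 - j) ((mm j (x ⊗ₜ[R] purePow R A a j)) ⊗ₜ[R]
            purePow R A (fun i => a (i + j)) (n - 1 - j)))
        + (∑ q ∈ Finset.range (n - 2),
            mm (n - 2) (x ⊗ₜ[R] purePow R A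
              (fun i => if i < q then a i else if i = q then a q * a (q + 1) else a (i + 1))
              (n - 2)))
        + (∑ p ∈ Finset.range n,
            mm n (x ⊗ₜ[R] purePow R A
              (fun i => if i < p then a i else if i = p then ω else a (i - 1)) n)) = 0)
    (X : ModuleCat R) (δ : ↥X →ₗ[R] A ⊗[R] ↥X)
    (hδ : (TensorProduct.map (LinearMap.mul' R A) (LinearMap.id : ↥X →ₗ[R] ↥X)) ∘ₗ
        (TensorProduct.assoc R A A ↥X).symm.toLinearMap ∘ₗ
        (LinearMap.lTensor A δ) ∘ₗ δ
      = TensorProduct.mk R A ↥X ω)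
    (hbdd : (∃ J : ℕ, ∀ j : ℕ, J ≤ j → iter R A X δ j = 0)
      ∨ (∃ J : ℕ, ∀ j : ℕ, J ≤ j → mm j = 0))
    (D : (↥M ⊗[R] ↥X) →ₗ[R] (↥M ⊗[R] ↥X))
    (hD : D = ∑ᶠ j : ℕ,
      (TensorProduct.map (mm j) (LinearMap.id : ↥X →ₗ[R] ↥X)) ∘ₗ
        (rearr R A X j M).toLinearMap ∘ₗ (LinearMap.lTensor ↥M (iter R A X δ j))) :
    D ∘ₗ D = 0 := by
  have hV : ∀ v : (↥M ⊗[R] ↥X) →ₗ[R] (↥M ⊗[R] ↥X), v + v = 0 := by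
    intro v
    have : ((1 : R) + 1) • v = 0 := by rw [h2, zero_smul]
    rwa [add_smul, one_smul] at this
  obtain ⟨J, hJ1, hJ2⟩ : ∃ J : ℕ, (∀ j, J ≤ j → dd δ mm j = 0) ∧ ∀ j, J ≤ j → CC δ mm ω j = 0 := by
    rcases hbdd with ⟨J, hJ⟩ | ⟨J, hJ⟩
    · refine ⟨J, fun j hj => ?_, fun j hj => ?_⟩
      · rw [dd, hJ j hj, LinearMap.lTensor_zero, LinearMap.comp_zero]
      · refine Finset.sum_eq_zero fun p _ => ?_
        rw [hJ j hj, LinearMap.lTensor_zero, LinearMap.comp_zero, LinearMap.comp_zero]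
    · refine ⟨J, fun j hj => ?_, fun j hj => ?_⟩
      · rw [dd, Phi, hJ j hj, TensorProduct.map_zero_left, LinearMap.zero_comp,
          LinearMap.zero_comp]
      · refine Finset.sum_eq_zero fun p _ => ?_
        rw [Phi, hJ (j + 1) (by omega), TensorProduct.map_zero_left, LinearMap.zero_comp,
          LinearMap.zero_comp]
  have hD' : D = ∑ j ∈ Finset.range J, dd δ mm j := by
    rw [hD]
    refine finsum_eq_sum_of_support_subset (fun j => dd δ mm j) ?_
    intro j hj
    rw [Finset.coe_range, Set.mem_Iio]
    by_contra hc
    exact hj (hJ1 j (by omega))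
  have tel := telescope hV
    (fun n => ∑ j ∈ Finset.range (n + 1), dd δ mm (n - j) ∘ₗ dd δ mm j)
    (CC δ mm ω) (BB δ mm ω) rfl rfl (fun _ => rfl) (rel δ mm ω hmm hδ) (2 * J)
  rw [hJ2 (2 * J) (by omega), hJ2 (2 * J + 1) (by omega), add_zero, add_zero] at tel
  rw [← tel, ← sum_pairs (fun i j => dd δ mm i ∘ₗ dd δ mm j) J
    (fun i j h => by rw [hJ1 i h, LinearMap.zero_comp])
    (fun i j h => by rw [hJ1 j h, LinearMap.comp_zero]), hD', sumComp]
  refine Finset.sum_congr rfl fun i _ => ?_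
  rw [compSum]

end
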